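/- For every task T = (I, O, Δ) there exists a set S of sequential executions over two operations — set(id, x), returning void, and get(id), returning an output value y — such that: S is prefix-closed; in every member of S each process identifier performs at most one set operation and at most one get operation, with its set preceding its get; and the map α that replaces, position-wise, each event inv(id, x) of an execution by a completed operation set(id, x) and each event res(id, y) by a completed operation get(id) returning y is a bijection from VE(T) onto S. In particular, α maps each invocation or response of a process id to an operation of the same process id, maps invocations with input x to completed set operations with input x, and maps responses with output y to completed get operations with output y. -/

import Mathlib

/-- An event of an execution of a task: an invocation `inv id x` by process `id` with
input `x`, or a response `res id y` to process `id` with output `y`. -/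
inductive Event (ι V W : Type) : Type
  | inv (id : ι) (x : V)
  | res (id : ι) (y : W)
deriving DecidableEq

/-- A completed operation of a set/get sequential object: `set id x` (returning void)
or `get id y` (returning the output value `y`).  A sequential execution is a finite
sequence (a list) of completed operations. -/
inductive Op (ι V W : Type) : Type
  | set (id : ι) (x : V)
  | get (id : ι) (y : W)
deriving DecidableEq

variable {ι V W : Type}

/-- The map `α` replacing, position-wise, each event `inv id x` by a completed
operation `set id x` and each event `res id y` by a completed operation `get id y`
(returning `y`). -/
def evToOp : Event ι V W → Op ι V W
  | .inv id x => .set id x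
  | .res id y => .get id y

/-- The list of (identifier, input) pairs of the invocations of an execution. -/
def invList (E : List (Event ι V W)) : List (ι × V) :=
  E.filterMap fun e =>
    match e with
    | .inv id x => some (id, x)
    | .res _ _ => none

/-- The list of (identifier, output) pairs of the responses of an execution. -/
def resList (E : List (Event ι V W)) : List (ι × W) :=
  E.filterMap fun e =>
    match e with
    | .inv _ _ => none
    | .res id y => some (id, y)

/-- Number of invocations by process `id` in an execution. -/
def invCount [DecidableEq ι] (id : ι) (E : List (Event ι V W)) : ℕ :=
  (invList E).countP fun p => decide (p.1 = id)

/-- Number of responses to process `id` in an execution. -/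
def resCount [DecidableEq ι] (id : ι) (E : List (Event ι V W)) : ℕ :=
  (resList E).countP fun p => decide (p.1 = id)

/-- An execution is well-formed if each identifier invokes at most once and responds
at most once, the response coming after the invocation. -/
def WellFormed [DecidableEq ι] (E : List (Event ι V W)) : Prop :=
  ∀ id : ι, invCount id E ≤ 1 ∧ resCount id E ≤ 1 ∧
    ∀ n : ℕ, resCount id (E.take n) ≤ invCount id (E.take n)

/-- The input simplex `σ_E` of an execution. -/
def sigmaF [DecidableEq ι] [DecidableEq V] (E : List (Event ι V W)) : Finset (ι × V) :=
  (invList E).toFinset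

/-- The output simplex `τ_E` of an execution. -/
def tauF [DecidableEq ι] [DecidableEq W] (E : List (Event ι V W)) : Finset (ι × W) :=
  (resList E).toFinset

/-- A simplex is chromatic: its vertices have pairwise distinct identifiers. -/
def Chromatic {α : Type} (σ : Finset (ι × α)) : Prop :=
  ∀ p ∈ σ, ∀ q ∈ σ, Prod.fst p = Prod.fst q → p = q

/-- A collection of simplexes closed under taking subsets (a complex). -/
def SubClosed {α : Type} (K : Set (Finset (ι × α))) : Prop :=
  ∀ σ ∈ K, ∀ σ' ⊆ σ, σ' ∈ K

/-- A complex is pure of dimension `n - 1`: every simplex is contained in a simplex of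
the complex with `n` vertices. -/
def PureOf {α : Type} (K : Set (Finset (ι × α))) (n : ℕ) : Prop :=
  ∀ σ ∈ K, ∃ ρ ∈ K, σ ⊆ ρ ∧ ρ.card = n

/-- `VE(T)`: the set of well-formed executions satisfying the task `T = (I, O, Δ)`:
for every prefix `E'`, `σ_{E'} ∈ I` and `τ_{E'} ∈ Δ(σ_{E'})`. -/
def VE [DecidableEq ι] [DecidableEq V] [DecidableEq W]
    (I : Set (Finset (ι × V))) (Δ : Finset (ι × V) → Set (Finset (ι × W))) :
    Set (List (Event ι V W)) :=
  {E | WellFormed E ∧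
    ∀ n : ℕ, sigmaF (E.take n) ∈ I ∧ tauF (E.take n) ∈ Δ (sigmaF (E.take n))}

/-- Number of `set` operations by process `id` in a sequential execution. -/
def setCount [DecidableEq ι] (id : ι) (s : List (Op ι V W)) : ℕ :=
  s.countP fun o =>
    match o with
    | .set id' _ => decide (id' = id)
    | .get _ _ => false

/-- Number of `get` operations by process `id` in a sequential execution. -/
def getCount [DecidableEq ι] (id : ι) (s : List (Op ι V W)) : ℕ :=
  s.countP fun o =>
    match o with
    | .set _ _ => false
    | .get id' _ => decide (id' = id)

/-- In a sequential execution of a set/get object, each process identifier performs at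
most one `set` operation and at most one `get` operation, its `set` preceding its
`get`. -/
def SetGetWF [DecidableEq ι] (s : List (Op ι V W)) : Prop :=
  ∀ id : ι, setCount id s ≤ 1 ∧ getCount id s ≤ 1 ∧
    ∀ n : ℕ, getCount id (s.take n) ≤ setCount id (s.take n)

theorem evToOp_injective : Function.Injective (evToOp : Event ι V W → Op ι V W) := by
  intro a b h
  cases a <;> cases b <;> simp_all [evToOp]

theorem setCount_map_evToOp [DecidableEq ι] (id : ι) (E : List (Event ι V W)) :
    setCount id (E.map evToOp) = invCount id E := by
  induction E with
  | nil => rfl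
  | cons e E ih =>
    cases e <;> simp_all [setCount, invCount, invList, evToOp, List.countP_cons]

theorem getCount_map_evToOp [DecidableEq ι] (id : ι) (E : List (Event ι V W)) :
    getCount id (E.map evToOp) = resCount id E := by
  induction E with
  | nil => rfl
  | cons e E ih =>
    cases e <;> simp_all [getCount, resCount, resList, evToOp, List.countP_cons]

theorem WellFormed.setGetWF_map [DecidableEq ι] {E : List (Event ι V W)} (h : WellFormed E) :
    SetGetWF (E.map evToOp) := by
  intro id
  simpa only [← List.map_take, setCount_map_evToOp, getCount_map_evToOp] using h id

theorem WellFormed.take [DecidableEq ι] {E : List (Event ι V W)} (h : WellFormed E) (m : ℕ) :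
    WellFormed (E.take m) := by
  intro id
  obtain ⟨hinv, hres, hle⟩ := h id
  have hsub := List.take_sublist m E
  refine ⟨((hsub.filterMap _).countP_le).trans hinv, ((hsub.filterMap _).countP_le).trans hres,
    fun k => ?_⟩
  simpa only [List.take_take] using hle (min k m)

theorem take_mem_VE [DecidableEq ι] [DecidableEq V] [DecidableEq W]
    {I : Set (Finset (ι × V))} {Δ : Finset (ι × V) → Set (Finset (ι × W))}
    {E : List (Event ι V W)} (h : E ∈ VE I Δ) (m : ℕ) : E.take m ∈ VE I Δ := by
  refine ⟨h.1.take m, fun k => ?_⟩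
  simpa only [List.take_take] using h.2 (min k m)

/-- For every task `T = (I, O, Δ)` there exists a set `S` of sequential executions
over the two operations `set(id, x)` and `get(id) : y` such that: `S` is
prefix-closed; in every member of `S` each process performs at most one `set` and at
most one `get`, with its `set` preceding its `get`; and the position-wise map `α`
replacing each event `inv id x` by a completed operation `set id x` and each event
`res id y` by a completed `get` operation of `id` returning `y` is a bijection from
`VE(T)` onto `S`.   In particular `α` maps each invocation or response of a process to
an operation of the same process, invocations with input `x` to completed `set`
operations with input `x`, and responses with output `y` to completed `get` operations
with output `y`. -/
theorem task_has_setget_sequential_object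
    {ι V W : Type} [DecidableEq ι] [DecidableEq V] [DecidableEq W] (n : ℕ)
    (I : Set (Finset (ι × V))) (O : Set (Finset (ι × W)))
    (Δ : Finset (ι × V) → Set (Finset (ι × W)))
    (hIchrom : ∀ σ ∈ I, Chromatic σ) (hOchrom : ∀ τ ∈ O, Chromatic τ)
    (hIclosed : SubClosed I) (hOclosed : SubClosed O)
    (hIpure : PureOf I n) (hOpure : PureOf O n)
    (hΔO : ∀ σ ∈ I, Δ σ ⊆ O)
    (hΔclosed : ∀ σ ∈ I, ∀ τ ∈ Δ σ, ∀ τ' ⊆ τ, τ' ∈ Δ σ)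
    (hΔpure : ∀ σ ∈ I, ∀ τ ∈ Δ σ, ∃ ρ ∈ Δ σ, τ ⊆ ρ ∧ ρ.card = σ.card)
    (hΔchrom : ∀ σ ∈ I, ∀ τ ∈ Δ σ, τ.card = σ.card →
      τ.image Prod.fst = σ.image Prod.fst)
    (hΔmono : ∀ σ ∈ I, ∀ σ' ∈ I, σ' ⊆ σ → Δ σ' ⊆ Δ σ) :
    ∃ S : Set (List (Op ι V W)),
      (∀ s ∈ S, ∀ s', s' <+: s → s' ∈ S) ∧
      (∀ s ∈ S, SetGetWF s) ∧
      Set.BijOn (List.map evToOp) (VE I Δ) S := by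
  refine ⟨List.map evToOp '' VE I Δ, ?_, ?_,
    (List.map_injective_iff.mpr evToOp_injective).injOn.bijOn_image⟩
  · rintro _ ⟨E, hE, rfl⟩ s' hs'
    refine ⟨E.take s'.length, take_mem_VE hE _, ?_⟩
    rw [List.map_take, ← List.prefix_iff_eq_take.mp hs']
  · rintro _ ⟨E, hE, rfl⟩
    exact hE.1.setGetWF_map
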